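/- arXiv:2411.05941 — 2 statements merged into one kernel-verified Lean document; each statement's English description precedes it below -/
import Mathlib

section
/- Define γ : ℕ₊ → ℤ by: γ(n) = Σ over pairs of positive integers (n₁,n₂) with n₁²+n₂² = n of χ_{−3}(n₂)·n₂, if n ≡ 2 (mod 3); γ(n) = (if n is a perfect square then χ_{−3}(√n)·√n else 0) + 2·Σ over pairs of positive integers (n₁,n₂) with n₁²+9n₂² = n of χ_{−3}(n₁)·n₁, if n ≡ 1 (mod 3); and γ(n) = 0 if 3 ∣ n. Then for every positive integer n, γ(n) = 0 if and only if 3 ∣ n or there exists a prime p ≡ 3 (mod 4) such that ord_p(n) is odd. -/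
open Finset

/-- The quadratic character modulo 3. -/
def χ₃ (m : ℕ) : ℤ := if m % 3 = 1 then 1 else if m % 3 = 2 then -1 else 0

/-- The arithmetic function `γ₁` attached to the newform `g₁ ∈ S₂(Γ₀(36), χ₁₂)`. -/
noncomputable def gamma1 (n : ℕ) : ℤ :=
  if n % 3 = 2 then
    ∑ p ∈ (Finset.Icc 1 n ×ˢ Finset.Icc 1 n).filter (fun p => p.1 ^ 2 + p.2 ^ 2 = n), χ₃ p.2 * p.2
  else if n % 3 = 1 then
    (if Nat.sqrt n * Nat.sqrt n = n then χ₃ (Nat.sqrt n) * (Nat.sqrt n : ℤ) else 0)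
      + 2 * ∑ p ∈ (Finset.Icc 1 n ×ˢ Finset.Icc 1 n).filter (fun p => p.1 ^ 2 + 9 * p.2 ^ 2 = n), χ₃ p.1 * p.1
  else 0


/-- Exponent table of the order-eight character of the field with nine elements. -/
def exTab (x y : ZMod 3) : ℕ :=
  if y = 0 then (if x = 1 then 0 else 4)
  else if x = 0 then (if y = 1 then 6 else 2)
  else if x = 1 then (if y = 1 then 1 else 3)
  else (if y = 1 then 7 else 5)

lemma exTab_mul : ∀ x y u v : ZMod 3, ¬ (x = 0 ∧ y = 0) → ¬ (u = 0 ∧ v = 0) →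
    ¬ (x * u - y * v = 0 ∧ x * v + y * u = 0) ∧
    exTab (x * u - y * v) (x * v + y * u) % 8 = (exTab x y + exTab u v) % 8 := by
  decide

noncomputable def om : ℂ := Classical.choose (IsAlgClosed.exists_pow_nat_eq Complex.I (n := 2) (by norm_num))

lemma om_sq : om ^ 2 = Complex.I :=
  Classical.choose_spec (IsAlgClosed.exists_pow_nat_eq Complex.I (n := 2) (by norm_num))

lemma om_four : om ^ 4 = -1 := by
  rw [show om ^ 4 = (om ^ 2) ^ 2 by ring, om_sq, Complex.I_sq]

lemma om_eight : om ^ 8 = 1 := by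
  rw [show om ^ 8 = (om ^ 4) ^ 2 by ring, om_four]; norm_num

lemma om_ne : om ≠ 0 := by
  intro h; have := om_four; rw [h] at this; norm_num at this

noncomputable def psi (z : GaussianInt) : ℂ :=
  if ((z.re : ZMod 3) = 0 ∧ (z.im : ZMod 3) = 0) then 0 else om ^ exTab (z.re : ZMod 3) (z.im : ZMod 3)

lemma psi_mul (z w : GaussianInt) : psi (z * w) = psi z * psi w := by
  have e1 : (((z * w).re : ℤ) : ZMod 3) = (z.re : ZMod 3) * w.re - z.im * w.im := by
    rw [Zsqrtd.re_mul]; push_cast; ring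
  have e2 : (((z * w).im : ℤ) : ZMod 3) = (z.re : ZMod 3) * w.im + z.im * w.re := by
    rw [Zsqrtd.im_mul]; push_cast; ring
  unfold psi
  rw [e1, e2]
  by_cases hz : ((z.re : ZMod 3) = 0 ∧ (z.im : ZMod 3) = 0)
  · simp [hz.1, hz.2]
  by_cases hw : ((w.re : ZMod 3) = 0 ∧ (w.im : ZMod 3) = 0)
  · simp [hw.1, hw.2]
  obtain ⟨h1, h2⟩ := exTab_mul _ _ _ _ hz hw
  rw [if_neg h1, if_neg hz, if_neg hw, ← pow_add]
  rw [pow_eq_pow_mod _ om_eight, h2, ← pow_eq_pow_mod _ om_eight]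

lemma psi_eight (z : GaussianInt) (h : ¬ ((z.re : ZMod 3) = 0 ∧ (z.im : ZMod 3) = 0)) :
    psi z ^ 8 = 1 := by
  unfold psi
  rw [if_neg h, ← pow_mul, mul_comm, pow_mul, om_eight, one_pow]

/-- The function summed: the Hecke character times its infinity type. -/
noncomputable def ff (z : GaussianInt) : ℂ := psi z * GaussianInt.toComplex z

lemma ff_mul (z w : GaussianInt) : ff (z * w) = ff z * ff w := by
  unfold ff; rw [psi_mul, map_mul]; ring

lemma norm_eq (z : GaussianInt) : z.norm = z.re ^ 2 + z.im ^ 2 := by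
  rw [Zsqrtd.norm_def]; ring

lemma fin_norm (n : ℕ) : {z : GaussianInt | z.norm = n}.Finite := by
  apply Set.Finite.subset (((Set.finite_Icc (-(n:ℤ)) n).prod (Set.finite_Icc (-(n:ℤ)) n)).image
    (fun p : ℤ × ℤ => (⟨p.1, p.2⟩ : GaussianInt)))
  intro z hz
  have h : z.norm = n := hz
  rw [norm_eq] at h
  have key : ∀ a b : ℤ, a ^ 2 + b ^ 2 = n → a ∈ Set.Icc (-(n:ℤ)) n := by
    intro a b hab
    constructor
    · nlinarith [sq_nonneg b, Int.le_self_sq (-a)]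
    · nlinarith [sq_nonneg b, Int.le_self_sq a]
  exact ⟨(z.re, z.im), ⟨key _ _ h, key z.im z.re (by linarith)⟩, rfl⟩

noncomputable def S (n : ℕ) : Finset GaussianInt := (fin_norm n).toFinset

lemma mem_S {n : ℕ} {z : GaussianInt} : z ∈ S n ↔ z.norm = n := by
  unfold S; simp

noncomputable def F (n : ℕ) : ℂ := ∑ z ∈ S n, ff z

lemma sum_dvd (g : GaussianInt) (c m : ℕ) (hc : 0 < c) (hg : g.norm = c)
    (P Q : GaussianInt → Prop) (hPQ : ∀ w, P (g * w) ↔ Q w)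
    [DecidablePred (fun z => g ∣ z ∧ P z)] [DecidablePred Q] :
    ∑ z ∈ (S (c * m)).filter (fun z => g ∣ z ∧ P z), ff z
      = ff g * ∑ z ∈ (S m).filter Q, ff z := by
  have hg0 : g ≠ 0 := by
    rintro rfl; simp at hg; omega
  rw [Finset.mul_sum]
  symm
  apply Finset.sum_bij (fun w _ => g * w)
  · intro w hw
    simp only [Finset.mem_filter, mem_S] at hw ⊢
    refine ⟨?_, Dvd.intro _ rfl, (hPQ w).2 hw.2⟩
    rw [Zsqrtd.norm_mul, hg, hw.1]; push_cast; ring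
  · intro a _ b _ h
    exact mul_left_cancel₀ hg0 h
  · intro z hz
    simp only [Finset.mem_filter, mem_S] at hz
    obtain ⟨h1, ⟨w, rfl⟩, h3⟩ := hz
    refine ⟨w, ?_, rfl⟩
    simp only [Finset.mem_filter, mem_S]
    refine ⟨?_, (hPQ w).1 h3⟩
    rw [Zsqrtd.norm_mul, hg] at h1
    push_cast at h1
    have : (c:ℤ) ≠ 0 := by exact_mod_cast hc.ne'
    exact mul_left_cancel₀ this h1
  · intro w _
    rw [ff_mul]

lemma F_all_dvd (g : GaussianInt) (c m : ℕ) (hc : 0 < c) (hg : g.norm = c)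
    (h : ∀ z : GaussianInt, z.norm = (c * m : ℕ) → g ∣ z) : F (c * m) = ff g * F m := by
  classical
  have := sum_dvd g c m hc hg (fun _ => True) (fun _ => True) (by simp)
  rw [Finset.filter_true] at this
  unfold F
  rw [← this, Finset.filter_true_of_mem]
  intro z hz
  exact ⟨h z (mem_S.1 hz), trivial⟩

lemma prime_of_norm (g : GaussianInt) (p : ℕ) (hp : p.Prime) (hg : g.norm = p) : Prime g := by
  rw [← irreducible_iff_prime]
  constructor
  · intro hu
    rw [← Zsqrtd.norm_eq_one_iff, hg] at hu
    simp at hu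
    exact hp.one_lt.ne' hu
  · intro a b hab
    have : a.norm.natAbs * b.norm.natAbs = p := by
      rw [← Int.natAbs_mul, ← Zsqrtd.norm_mul, ← hab, hg]; simp
    rw [← Zsqrtd.norm_eq_one_iff, ← Zsqrtd.norm_eq_one_iff]
    have hp' := hp
    rw [← this, Nat.prime_mul_iff] at hp'
    tauto

lemma ff_ne (z : GaussianInt) (h : ¬ (3:ℤ) ∣ z.norm) : ff z ≠ 0 ∧
    ff z ^ 8 = GaussianInt.toComplex (z ^ 8) := by
  have h0 : ¬ ((z.re : ZMod 3) = 0 ∧ (z.im : ZMod 3) = 0) := by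
    rintro ⟨h1, h2⟩
    rw [ZMod.intCast_zmod_eq_zero_iff_dvd] at h1 h2
    apply h
    rw [norm_eq]
    exact dvd_add (dvd_pow (by exact_mod_cast h1) two_ne_zero) (dvd_pow (by exact_mod_cast h2) two_ne_zero)
  have h8 := psi_eight z h0
  have hz : z ≠ 0 := by rintro rfl; simp at h
  constructor
  · unfold ff
    refine mul_ne_zero ?_ ?_
    · intro h; rw [h] at h8; norm_num at h8
    · simpa using hz
  · unfold ff
    rw [mul_pow, h8, one_mul, map_pow]

lemma dvd_or (g : GaussianInt) (p : ℕ) (hp : p.Prime) (hg : g.norm = p) (z : GaussianInt)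
    (hz : (p : ℤ) ∣ z.norm) : g ∣ z ∨ star g ∣ z := by
  have hgp := prime_of_norm g p hp hg
  have h1 : g ∣ z * star z := by
    rw [← Zsqrtd.norm_eq_mul_conj]
    have h2 : ((p:ℤ) : GaussianInt) ∣ (z.norm : GaussianInt) := by
      obtain ⟨k, hk⟩ := hz
      exact ⟨k, by rw [hk]; push_cast; rfl⟩
    refine dvd_trans ?_ h2
    rw [← hg, Zsqrtd.norm_eq_mul_conj]
    exact Dvd.intro _ rfl
  rcases hgp.dvd_or_dvd h1 with h | h
  · exact Or.inl h
  · right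
    obtain ⟨k, hk⟩ := h
    exact ⟨star k, by rw [← star_star z, hk]; simp [mul_comm]⟩

lemma gnorm_star (g : GaussianInt) : (star g).norm = g.norm := by
  rw [norm_eq, norm_eq]; simp

lemma not_dvd_star (g : GaussianInt) (p : ℕ) (hp : p.Prime) (h2 : p ≠ 2) (hg : g.norm = p) :
    ¬ g ∣ star g := by
  intro h
  have h1 : g ∣ ((2 * g.re : ℤ) : GaussianInt) := by
    have : ((2 * g.re : ℤ) : GaussianInt) = g + star g := by
      ext <;> simp
      ring
    rw [this]; exact dvd_add dvd_rfl h
  obtain ⟨k, hk⟩ := h1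
  have h3 : (p:ℤ) ∣ (2 * g.re) * (2 * g.re) := by
    have := congrArg Zsqrtd.norm hk
    rw [Zsqrtd.norm_intCast, Zsqrtd.norm_mul, hg] at this
    exact ⟨_, this⟩
  have hpi : Prime (p:ℤ) := Nat.prime_iff_prime_int.1 hp
  have h4 : (p:ℤ) ∣ 2 * g.re := by
    rcases hpi.dvd_or_dvd h3 with h | h <;> exact h
  have h5 : (p:ℤ) ∣ g.re := by
    rcases hpi.dvd_or_dvd h4 with h | h
    · exfalso
      have : p ∣ 2 := by exact_mod_cast h
      exact h2 ((Nat.prime_dvd_prime_iff_eq hp Nat.prime_two).1 this)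
    · exact h
  rw [norm_eq] at hg
  have hpp := hp.two_le
  obtain ⟨t, ht⟩ := h5
  have h6 : (p:ℤ) ∣ g.im := by
    apply hpi.dvd_of_dvd_pow (n := 2)
    rw [show g.im ^ 2 = p - g.re ^ 2 by linarith, ht]
    exact ⟨1 - p * t ^ 2, by ring⟩
  obtain ⟨s, hs⟩ := h6
  rw [ht, hs] at hg
  have h7 : (p:ℤ) * (p * (t ^ 2 + s ^ 2)) = p * 1 := by linarith
  have h8 := mul_left_cancel₀ hpi.ne_zero h7
  have h9 : (p:ℤ) ∣ 1 := ⟨_, h8.symm⟩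
  have : p ∣ 1 := by exact_mod_cast h9
  exact hp.one_lt.ne' (Nat.dvd_one.1 this)

open Classical in
lemma split_step (g : GaussianInt) (p : ℕ) (hp : p.Prime) (h2 : p ≠ 2) (hg : g.norm = p)
    (m : ℕ) (hm : ¬ p ∣ m) (k : ℕ) :
    ∑ z ∈ (S (p ^ k * m)).filter (fun z => ¬ g ∣ z), ff z = ff (star g) ^ k * F m := by
  induction k with
  | zero =>
    rw [Finset.filter_true_of_mem]
    · simp [F]
    · rintro z hz ⟨w, rfl⟩
      rw [mem_S, Zsqrtd.norm_mul, hg] at hz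
      apply hm
      have : (p:ℤ) ∣ m := ⟨_, by rw [hz]; simp⟩
      exact_mod_cast this
  | succ k ih =>
    have hgp := prime_of_norm g p hp hg
    have := sum_dvd (star g) p (p ^ k * m) hp.pos (by rw [gnorm_star, hg]) (fun z => ¬ g ∣ z)
      (fun z => ¬ g ∣ z) (by
        intro w
        rw [not_iff_not]
        constructor
        · intro h
          exact (hgp.dvd_or_dvd h).resolve_left (not_dvd_star g p hp h2 hg)
        · intro h; exact dvd_mul_of_dvd_right h _)
    rw [ih] at this
    rw [pow_succ', mul_assoc, pow_succ' (ff _), mul_assoc, ← this]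
    apply Finset.sum_congr _ (fun _ _ => rfl)
    apply Finset.filter_congr
    intro z hz
    rw [mem_S] at hz
    have := dvd_or g p hp hg z (by rw [hz]; push_cast; exact Dvd.intro _ rfl)
    tauto

lemma F_split (g : GaussianInt) (p : ℕ) (hp : p.Prime) (h2 : p ≠ 2) (hg : g.norm = p)
    (m : ℕ) (hm : ¬ p ∣ m) (k : ℕ) :
    (ff g - ff (star g)) * F (p ^ k * m) = (ff g ^ (k+1) - ff (star g) ^ (k+1)) * F m := by
  classical
  induction k with
  | zero => simp
  | succ k ih =>
    have h := Finset.sum_filter_add_sum_filter_not (S (p ^ (k+1) * m)) (fun z => g ∣ z) ff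
    rw [split_step g p hp h2 hg m hm] at h
    have h3 := sum_dvd g p (p ^ k * m) hp.pos hg (fun _ => True) (fun _ => True) (by simp)
    rw [Finset.filter_true] at h3
    simp only [and_true] at h3
    rw [← mul_assoc, ← pow_succ'] at h3
    rw [h3] at h
    change _ = F _ at h
    change _ * F (p ^ k * m) + _ = F _ at h
    rw [← h, mul_add, mul_left_comm, ih]
    ring

lemma F_split_ne (p : ℕ) (hp : p.Prime) (h4 : p % 4 = 1) (m : ℕ) (hm : ¬ p ∣ m) (k : ℕ)
    (hF : F m ≠ 0) : F (p ^ k * m) ≠ 0 := by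
  have := Fact.mk hp
  obtain ⟨a, b, hab⟩ := Nat.Prime.sq_add_sq (p := p) (by omega)
  have h2 : p ≠ 2 := by omega
  set g : GaussianInt := ⟨a, b⟩ with hgdef
  have hg : g.norm = p := by rw [norm_eq, ← hab]; push_cast; rfl
  have h3 : ¬ (3:ℤ) ∣ g.norm := by
    rw [hg]; intro h
    have : 3 ∣ p := by exact_mod_cast h
    have := (Nat.prime_dvd_prime_iff_eq Nat.prime_three hp).1 this
    omega
  have h := F_split g p hp h2 hg m hm k
  intro h0
  rw [h0, mul_zero] at h
  have h5 := (mul_eq_zero.1 h.symm).resolve_right hF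
  have h6 : (ff g ^ (k+1)) ^ 8 = (ff (star g) ^ (k+1)) ^ 8 := by rw [sub_eq_zero.1 h5]
  rw [← pow_mul, ← pow_mul, mul_comm, pow_mul, pow_mul, (ff_ne g h3).2,
    (ff_ne (star g) (by rw [gnorm_star]; exact h3)).2, ← map_pow, ← map_pow] at h6
  have h7 := GaussianInt.toComplex_injective h6
  have hgp := prime_of_norm g p hp hg
  apply not_dvd_star g p hp h2 hg
  apply hgp.dvd_of_dvd_pow (n := 8)
  apply hgp.dvd_of_dvd_pow (n := k+1)
  rw [← h7]
  exact dvd_pow (dvd_pow_self _ (by norm_num)) (by omega)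

lemma S_split (p : ℕ) (hp : p.Prime) (h4 : p % 4 = 1) (m : ℕ) (k : ℕ)
    (hS : (S (p ^ k * m)).Nonempty) : (S m).Nonempty := by
  have := Fact.mk hp
  obtain ⟨a, b, hab⟩ := Nat.Prime.sq_add_sq (p := p) (by omega)
  set g : GaussianInt := ⟨a, b⟩ with hgdef
  have hg : g.norm = p := by rw [norm_eq, ← hab]; push_cast; rfl
  have hp0 : (p:ℤ) ≠ 0 := by exact_mod_cast hp.ne_zero
  induction k with
  | zero => simpa using hS
  | succ k ih =>
    apply ih
    obtain ⟨z, hz⟩ := hS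
    rw [mem_S] at hz
    rw [pow_succ', mul_assoc, Nat.cast_mul] at hz
    rcases dvd_or g p hp hg z (by rw [hz]; exact Dvd.intro _ rfl) with ⟨w, rfl⟩ | ⟨w, rfl⟩
    · rw [Zsqrtd.norm_mul, hg] at hz
      exact ⟨w, mem_S.2 (mul_left_cancel₀ hp0 hz)⟩
    · rw [Zsqrtd.norm_mul, gnorm_star, hg] at hz
      exact ⟨w, mem_S.2 (mul_left_cancel₀ hp0 hz)⟩

lemma inert_dvd (q : ℕ) (hq : q.Prime) (h4 : q % 4 = 3) (z : GaussianInt) (hz : (q:ℤ) ∣ z.norm) :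
    (q : GaussianInt) ∣ z := by
  have := Fact.mk hq
  have hgp := GaussianInt.prime_of_nat_prime_of_mod_four_eq_three q h4
  have h1 : (q : GaussianInt) ∣ z * star z := by
    rw [← Zsqrtd.norm_eq_mul_conj]
    obtain ⟨k, hk⟩ := hz
    exact ⟨k, by rw [hk]; push_cast; rfl⟩
  rcases hgp.dvd_or_dvd h1 with h | h
  · exact h
  · obtain ⟨k, hk⟩ := h
    exact ⟨star k, by rw [← star_star z, hk]; simp [mul_comm]⟩

lemma two_dvd (z : GaussianInt) (hz : (2:ℤ) ∣ z.norm) : (⟨1, 1⟩ : GaussianInt) ∣ z := by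
  rw [norm_eq] at hz
  have h : (2:ℤ) ∣ z.re + z.im := by
    have e : z.re ^ 2 + z.im ^ 2 = z.re + z.im + (z.re * (z.re - 1) + z.im * (z.im - 1)) := by ring
    have h1 := Int.even_mul_pred_self z.re
    have h2 := Int.even_mul_pred_self z.im
    have := (h1.add h2).two_dvd
    rw [e] at hz
    exact (Int.dvd_iff_dvd_of_dvd_add hz).2 this
  obtain ⟨k, hk⟩ := h
  refine ⟨⟨k, z.im - k⟩, ?_⟩
  ext <;> simp [Zsqrtd.re_mul, Zsqrtd.im_mul] <;> linarith

lemma S_one : S 1 = {1, -1, ⟨0,1⟩, ⟨0,-1⟩} := by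
  ext z
  rw [mem_S, norm_eq]
  simp only [Finset.mem_insert, Finset.mem_singleton, Zsqrtd.ext_iff]
  simp
  constructor
  · intro h
    have h1 : z.re ≤ 1 := by nlinarith [sq_nonneg z.im]
    have h2 : -1 ≤ z.re := by nlinarith [sq_nonneg z.im]
    have h3 : z.im ≤ 1 := by nlinarith [sq_nonneg z.re]
    have h4 : -1 ≤ z.im := by nlinarith [sq_nonneg z.re]
    generalize z.re = x at *
    generalize z.im = y at *
    interval_cases x <;> interval_cases y <;> simp at h ⊢
  · rintro (h | h | h | h) <;> simp [h.1, h.2]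

lemma ff_I (z : GaussianInt) : ff (⟨0, 1⟩ * z) = ff z := by
  rw [ff_mul]
  have : ff ⟨0, 1⟩ = 1 := by
    have e : exTab 0 1 = 6 := by decide
    simp [ff, psi, GaussianInt.toComplex_def, e]
    rw [show om ^ 6 = om ^ 4 * om ^ 2 by ring, om_four, om_sq]; simp
  rw [this, one_mul]

lemma F_one : F 1 ≠ 0 := by
  have h0 : ff 1 = 1 := by
    have e : exTab 1 0 = 0 := by decide
    simp [ff, psi, GaussianInt.toComplex_def, e]
  have h1 : ff ⟨0,1⟩ = 1 := by rw [← h0, ← ff_I 1]; simp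
  have h2 : ff (-1) = 1 := by rw [← h1, ← ff_I ⟨0,1⟩]; congr 1
  have h3 : ff ⟨0,-1⟩ = 1 := by rw [← h2, ← ff_I (-1)]; congr 1
  unfold F
  rw [S_one, Finset.sum_insert (by decide), Finset.sum_insert (by decide),
    Finset.sum_insert (by decide), Finset.sum_singleton, h0, h1, h2, h3]
  norm_num

lemma F_ne (n : ℕ) (hn : 0 < n) (h3 : ¬ 3 ∣ n) (hS : (S n).Nonempty) : F n ≠ 0 := by
  induction n using Nat.strong_induction_on with
  | _ n ih =>
  by_cases h1 : n = 1
  · rw [h1]; exact F_one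
  obtain ⟨p, hp, hpn⟩ := Nat.exists_prime_and_dvd h1
  have hp0 : (p:ℤ) ≠ 0 := by exact_mod_cast hp.ne_zero
  rcases hp.eq_two_or_odd with h2 | hodd
  · subst h2
    obtain ⟨m, rfl⟩ := hpn
    have hdv : ∀ z : GaussianInt, z.norm = (2 * m : ℕ) → (⟨1,1⟩ : GaussianInt) ∣ z := by
      intro z hz
      apply two_dvd; rw [hz]; push_cast; exact Dvd.intro _ rfl
    have hg : (⟨1,1⟩ : GaussianInt).norm = (2:ℕ) := by decide
    rw [F_all_dvd ⟨1,1⟩ 2 m (by norm_num) hg hdv]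
    refine mul_ne_zero (ff_ne _ (by rw [hg]; decide)).1 (ih m (by omega) (by omega) (by omega) ?_)
    obtain ⟨z, hz⟩ := hS
    rw [mem_S] at hz
    obtain ⟨w, rfl⟩ := hdv z hz
    refine ⟨w, mem_S.2 ?_⟩
    rw [Zsqrtd.norm_mul, hg] at hz
    push_cast at hz
    linarith
  · have h4 : p % 4 = 1 ∨ p % 4 = 3 := by omega
    rcases h4 with h4 | h4
    · obtain ⟨k, m, hm, rfl⟩ := Nat.exists_eq_pow_mul_and_not_dvd hn.ne' p hp.ne_one
      have hk : k ≠ 0 := by rintro rfl; simp at hpn; exact hm hpn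
      have hm0 : 0 < m := by
        rcases Nat.eq_zero_or_pos m with h | h
        · simp [h] at hn
        · exact h
      apply F_split_ne p hp h4 m hm k
      apply ih m _ hm0 (fun h => h3 (dvd_mul_of_dvd_right h _)) (S_split p hp h4 m k hS)
      have := Nat.one_lt_pow hk hp.one_lt
      nlinarith
    · have hg : ((p : GaussianInt)).norm = (p * p : ℕ) := by
        rw [Zsqrtd.norm_natCast]; push_cast; rfl
      obtain ⟨z, hz⟩ := hS
      rw [mem_S] at hz
      obtain ⟨w, rfl⟩ := inert_dvd p hp h4 z (by rw [hz]; exact_mod_cast hpn)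
      rw [Zsqrtd.norm_mul, hg] at hz
      have hw : w.norm = (w.norm.natAbs : ℤ) := (Int.natAbs_of_nonneg (GaussianInt.norm_nonneg w)).symm
      set m := w.norm.natAbs with hmdef
      have hnm : n = p * p * m := by rw [hw] at hz; exact_mod_cast hz.symm
      have hm0 : 0 < m := by
        rcases Nat.eq_zero_or_pos m with h | h
        · rw [h] at hnm; omega
        · exact h
      rw [hnm] at h3 ⊢
      rw [F_all_dvd (p : GaussianInt) (p * p) m (Nat.mul_pos hp.pos hp.pos) hg]
      · refine mul_ne_zero (ff_ne _ ?_).1 (ih m ?_ hm0 ?_ ⟨w, mem_S.2 hw⟩)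
        · rw [hg]; intro h
          exact h3 (dvd_mul_of_dvd_left (by exact_mod_cast h) _)
        · have := hp.two_le
          have h5 : 4 ≤ p * p := by nlinarith
          nlinarith
        · exact fun h => h3 (dvd_mul_of_dvd_right h _)
      · intro z hz
        apply inert_dvd p hp h4 z
        rw [hz]; push_cast; rw [mul_assoc]; exact Dvd.intro _ rfl

lemma fib (T : Finset GaussianInt) (P : Finset (ℕ × ℕ)) (h : GaussianInt → ℂ)
    (hT : ∀ z : GaussianInt, z ∈ T ↔ (z.re.natAbs, z.im.natAbs) ∈ P)
    (hP : ∀ p ∈ P, 0 < p.1 ∧ 0 < p.2) :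
    ∑ z ∈ T, h z = ∑ p ∈ P, (h ⟨p.1, p.2⟩ + h ⟨p.1, -p.2⟩ + h ⟨-p.1, p.2⟩ + h ⟨-p.1, -p.2⟩) := by
  classical
  rw [← Finset.sum_fiberwise_of_maps_to (s := T) (t := P)
    (g := fun z => (z.re.natAbs, z.im.natAbs)) (fun z hz => (hT z).1 hz)]
  apply Finset.sum_congr rfl
  rintro ⟨a, b⟩ hp
  obtain ⟨ha, hb⟩ := hP _ hp
  simp only at ha hb
  have : T.filter (fun z => (z.re.natAbs, z.im.natAbs) = (a, b)) =
      {⟨a, b⟩, ⟨a, -b⟩, ⟨-a, b⟩, ⟨-a, -b⟩} := by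
    ext z
    simp only [Finset.mem_filter, Finset.mem_insert, Finset.mem_singleton, Zsqrtd.ext_iff,
      Prod.mk.injEq]
    constructor
    · rintro ⟨_, h1, h2⟩
      omega
    · intro hz
      have h1 : z.re.natAbs = a := by omega
      have h2 : z.im.natAbs = b := by omega
      refine ⟨?_, h1, h2⟩
      rw [hT, h1, h2]; exact hp
  rw [this, Finset.sum_insert, Finset.sum_insert, Finset.sum_insert, Finset.sum_singleton]
  · ring
  all_goals
    simp only [Finset.mem_insert, Finset.mem_singleton, Zsqrtd.ext_iff]
    omega

lemma cast3 (a : ℕ) : (a % 3 = 0 ∧ (a : ZMod 3) = 0 ∧ χ₃ a = 0) ∨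
    (a % 3 = 1 ∧ (a : ZMod 3) = 1 ∧ χ₃ a = 1) ∨ (a % 3 = 2 ∧ (a : ZMod 3) = -1 ∧ χ₃ a = -1) := by
  have h : (a : ZMod 3) = ((a % 3 : ℕ) : ZMod 3) := by simp
  have : a % 3 = 0 ∨ a % 3 = 1 ∨ a % 3 = 2 := by omega
  rcases this with h0 | h0 | h0
  · left; rw [h, h0]; simp [χ₃, h0]
  · right; left; rw [h, h0]; simp [χ₃, h0]
  · right; right; rw [h, h0]; simp [χ₃, h0]; decide

lemma om3 : om ^ 3 = Complex.I * om := by rw [← om_sq]; ring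
lemma om5 : om ^ 5 = - om := by
  rw [show om ^ 5 = om ^ 4 * om by ring, om_four]; ring
lemma om7 : om ^ 7 = - (Complex.I * om) := by
  rw [show om ^ 7 = om ^ 4 * om ^ 3 by ring, om_four, om3]; ring

lemma tab1 : exTab 1 1 = 1 := by decide
lemma tab2 : exTab 1 (-1) = 3 := by decide
lemma tab3 : exTab (-1) 1 = 7 := by decide
lemma tab4 : exTab (-1) (-1) = 5 := by decide
lemma tab5 : exTab 1 0 = 0 := by decide
lemma tab6 : exTab (-1) 0 = 4 := by decide

lemma fibsum2 (a b : ℕ) (ha : a % 3 ≠ 0) (hb : b % 3 ≠ 0) :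
    ff ⟨a, b⟩ + ff ⟨a, -b⟩ + ff ⟨-a, b⟩ + ff ⟨-a, -b⟩
      = 2 * om * (1 + Complex.I) * ((χ₃ a : ℂ) * a + (χ₃ b : ℂ) * b) := by
  have hI := Complex.I_sq
  rcases cast3 a with ⟨h, _⟩ | ⟨_, ha1, ha2⟩ | ⟨_, ha1, ha2⟩
  · exact absurd h ha
  all_goals
    rcases cast3 b with ⟨h, _⟩ | ⟨_, hb1, hb2⟩ | ⟨_, hb1, hb2⟩
    · exact absurd h hb
    all_goals
      simp [ff, psi, GaussianInt.toComplex_def, ha1, ha2, hb1, hb2, tab1, tab2, tab3, tab4,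
        om3, om5, om7]
      grind

lemma fibsum1 (a b : ℕ) (ha : a % 3 ≠ 0) (hb : (b : ZMod 3) = 0) :
    ff ⟨a, b⟩ = (χ₃ a : ℂ) * (a + b * Complex.I) ∧ ff ⟨a, -b⟩ = (χ₃ a : ℂ) * (a - b * Complex.I) ∧
    ff ⟨-a, b⟩ = (χ₃ a : ℂ) * (a - b * Complex.I) ∧ ff ⟨-a, -b⟩ = (χ₃ a : ℂ) * (a + b * Complex.I) := by
  rcases cast3 a with ⟨h, _⟩ | ⟨_, ha1, ha2⟩ | ⟨_, ha1, ha2⟩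
  · exact absurd h ha
  all_goals
    refine ⟨?_, ?_, ?_, ?_⟩ <;>
    · simp [ff, psi, GaussianInt.toComplex_def, ha1, ha2, hb, tab5, tab6, om_four]
      try ring

lemma F_eq2 (n : ℕ) (hn : n % 3 = 2) :
    F n = 4 * om * (1 + Complex.I) * (gamma1 n : ℂ) := by
  have hmod : ∀ a b : ℕ, a ^ 2 + b ^ 2 = n → a % 3 ≠ 0 ∧ b % 3 ≠ 0 := by
    intro a b hab
    rw [← hab, Nat.add_mod, Nat.pow_mod, Nat.pow_mod b] at hn
    have h1 : a % 3 < 3 := Nat.mod_lt _ (by norm_num)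
    have h2 : b % 3 < 3 := Nat.mod_lt _ (by norm_num)
    generalize a % 3 = x at *
    generalize b % 3 = y at *
    interval_cases x <;> interval_cases y <;> simp_all
  unfold F gamma1
  rw [if_pos hn]
  set P := (Finset.Icc 1 n ×ˢ Finset.Icc 1 n).filter (fun p => p.1 ^ 2 + p.2 ^ 2 = n) with hP
  have memP : ∀ a b : ℕ, (a, b) ∈ P ↔ a ^ 2 + b ^ 2 = n := by
    intro a b
    simp only [hP, Finset.mem_filter, Finset.mem_product, Finset.mem_Icc]
    refine ⟨fun h => h.2, fun h => ⟨?_, h⟩⟩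
    have := hmod a b h
    have ha : 1 ≤ a := by omega
    have hb : 1 ≤ b := by omega
    exact ⟨⟨ha, by nlinarith⟩, hb, by nlinarith⟩
  rw [fib (S n) P ff]
  · rw [Finset.sum_congr rfl (g := fun p : ℕ × ℕ =>
      2 * om * (1 + Complex.I) * ((χ₃ p.1 : ℂ) * p.1 + (χ₃ p.2 : ℂ) * p.2))]
    · rw [← Finset.mul_sum, Finset.sum_add_distrib]
      have hsw : ∑ p ∈ P, (χ₃ p.1 : ℂ) * p.1 = ∑ p ∈ P, (χ₃ p.2 : ℂ) * p.2 := by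
        apply Finset.sum_bij (fun p _ => (p.2, p.1))
        · rintro ⟨a, b⟩ h
          rw [memP] at h ⊢
          simp only
          omega
        · rintro ⟨a, b⟩ _ ⟨c, d⟩ _ h
          simp only [Prod.mk.injEq] at h ⊢
          tauto
        · rintro ⟨a, b⟩ h
          refine ⟨(b, a), ?_, rfl⟩
          rw [memP] at h ⊢
          omega
        · intros; rfl
      rw [hsw]
      push_cast
      ring
    · rintro ⟨a, b⟩ h
      obtain ⟨h1, h2⟩ := hmod a b ((memP a b).1 h)
      exact fibsum2 a b h1 h2
  · intro z
    rw [memP, mem_S, norm_eq, ← Int.natAbs_sq z.re, ← Int.natAbs_sq z.im]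
    norm_cast
  · rintro ⟨a, b⟩ h
    have := hmod a b ((memP a b).1 h)
    simp only
    omega

lemma zmod1 (x y : ℤ) (n : ℕ) (hn : n % 3 = 1) (h : x ^ 2 + y ^ 2 = n) :
    (3 ∣ x ∧ ¬ 3 ∣ y) ∨ (¬ 3 ∣ x ∧ 3 ∣ y) := by
  have h1 : (x ^ 2 + y ^ 2) % 3 = 1 := by rw [h]; omega
  have hx : x % 3 = 0 ∨ x % 3 = 1 ∨ x % 3 = 2 := by omega
  have hy : y % 3 = 0 ∨ y % 3 = 1 ∨ y % 3 = 2 := by omega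
  rw [Int.add_emod, pow_two, pow_two, Int.mul_emod, Int.mul_emod y] at h1
  rcases hx with hx | hx | hx <;> rcases hy with hy | hy | hy <;> rw [hx, hy] at h1 <;> omega

lemma F_eq1 (n : ℕ) (hn : n % 3 = 1) : F n = 4 * (gamma1 n : ℂ) := by
  classical
  have hsw : ∑ z ∈ (S n).filter (fun z => ¬ (3:ℤ) ∣ z.im), ff z =
      ∑ z ∈ (S n).filter (fun z => (3:ℤ) ∣ z.im), ff z := by
    apply Finset.sum_bij (fun z _ => (⟨0, 1⟩ : GaussianInt) * z)
    · intro z hz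
      simp only [Finset.mem_filter, mem_S, norm_eq] at hz ⊢
      have := zmod1 _ _ n hn hz.1
      simp [Zsqrtd.re_mul, Zsqrtd.im_mul]
      refine ⟨by linarith [hz.1], by tauto⟩
    · intro a _ b _ h
      exact mul_left_cancel₀ (by decide) h
    · intro z hz
      refine ⟨⟨0, -1⟩ * z, ?_, ?_⟩
      · simp only [Finset.mem_filter, mem_S, norm_eq] at hz ⊢
        have := zmod1 _ _ n hn hz.1
        simp [Zsqrtd.re_mul, Zsqrtd.im_mul]
        refine ⟨by linarith [hz.1], by tauto⟩
      · ext <;> simp [Zsqrtd.re_mul, Zsqrtd.im_mul]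
    · intro z _
      rw [ff_I]
  have hF : F n = 2 * ∑ z ∈ (S n).filter (fun z => (3:ℤ) ∣ z.im), ff z := by
    unfold F
    rw [← Finset.sum_filter_add_sum_filter_not (S n) (fun z => (3:ℤ) ∣ z.im) ff, hsw]
    ring
  rw [hF, ← Finset.sum_filter_add_sum_filter_not _ (fun z => z.im = 0) ff]
  have h0 : ∑ z ∈ ((S n).filter (fun z => (3:ℤ) ∣ z.im)).filter (fun z => z.im = 0), ff z
      = 2 * ((if Nat.sqrt n * Nat.sqrt n = n then χ₃ (Nat.sqrt n) * (Nat.sqrt n : ℤ) else 0 : ℤ) : ℂ) := by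
    by_cases hs : Nat.sqrt n * Nat.sqrt n = n
    · rw [if_pos hs]
      set s := Nat.sqrt n
      have hs3 : s % 3 ≠ 0 := by
        intro h
        rw [← hs, Nat.mul_mod, h] at hn
        simp at hn
      have : ((S n).filter (fun z => (3:ℤ) ∣ z.im)).filter (fun z => z.im = 0)
          = {⟨s, (0:ℕ)⟩, ⟨-s, (0:ℕ)⟩} := by
        ext z
        simp only [Finset.mem_filter, mem_S, norm_eq, Finset.mem_insert, Finset.mem_singleton,
          Zsqrtd.ext_iff]
        have hsz : (s:ℤ) * s = n := by exact_mod_cast hs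
        constructor
        · rintro ⟨⟨h1, _⟩, h2⟩
          rw [h2] at h1
          have : z.re ^ 2 = (s:ℤ) ^ 2 := by linarith
          rcases sq_eq_sq_iff_eq_or_eq_neg.1 this with h | h <;> simp [h, h2]
        · rintro (⟨h1, h2⟩ | ⟨h1, h2⟩) <;> rw [h1, h2] <;> simp <;> linarith
      rw [this, Finset.sum_insert, Finset.sum_singleton]
      · have := fibsum1 s 0 hs3 (by simp)
        rw [this.1, this.2.2.1]
        push_cast
        ring
      · simp only [Finset.mem_singleton, Zsqrtd.ext_iff]
        omega
    · rw [if_neg hs, Finset.filter_eq_empty_iff.2]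
      · simp
      · intro z hz h2
        simp only [Finset.mem_filter, mem_S, norm_eq] at hz
        apply hs
        rw [← Nat.exists_mul_self n]
        refine ⟨z.re.natAbs, ?_⟩
        have := hz.1
        rw [h2] at this
        zify
        rw [← this, ← pow_two, sq_abs]; ring
  set P := (Finset.Icc 1 n ×ˢ Finset.Icc 1 n).filter (fun p => p.1 ^ 2 + 9 * p.2 ^ 2 = n) with hP
  have hmod : ∀ a b : ℕ, a ^ 2 + 9 * b ^ 2 = n → a % 3 ≠ 0 := by
    intro a b hab h
    obtain ⟨c, rfl⟩ := Nat.dvd_of_mod_eq_zero h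
    rw [mul_pow] at hab
    omega
  have memP : ∀ a b : ℕ, (a, b) ∈ P ↔ 0 < b ∧ a ^ 2 + 9 * b ^ 2 = n := by
    intro a b
    simp only [hP, Finset.mem_filter, Finset.mem_product, Finset.mem_Icc]
    refine ⟨fun h => ⟨h.1.2.1, h.2⟩, fun h => ⟨?_, h.2⟩⟩
    have := hmod a b h.2
    have ha : 1 ≤ a := by omega
    exact ⟨⟨ha, by nlinarith⟩, h.1, by nlinarith⟩
  have h1 : ∑ z ∈ ((S n).filter (fun z => (3:ℤ) ∣ z.im)).filter (fun z => ¬ z.im = 0), ff z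
      = 4 * ∑ p ∈ P, (χ₃ p.1 : ℂ) * p.1 := by
    rw [fib _ (P.image (fun p => (p.1, 3 * p.2))) ff]
    · rw [Finset.sum_image, Finset.mul_sum]
      · apply Finset.sum_congr rfl
        rintro ⟨a, b⟩ h
        rw [memP] at h
        have h3 : (3 : ZMod 3) = 0 := by decide
        obtain ⟨e1, e2, e3, e4⟩ := fibsum1 a (3 * b) (hmod a b h.2) (by push_cast; rw [h3, zero_mul])
        simp only
        rw [e1, e2, e3, e4]
        ring
      · rintro ⟨a, b⟩ _ ⟨c, d⟩ _ h
        simp only [Prod.mk.injEq] at h ⊢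
        omega
    · intro z
      simp only [Finset.mem_filter, mem_S, norm_eq, Finset.mem_image, Prod.exists, memP,
        Prod.mk.injEq]
      constructor
      · rintro ⟨⟨h1, k, hk⟩, h2⟩
        refine ⟨z.re.natAbs, k.natAbs, ⟨by omega, ?_⟩, rfl, by omega⟩
        zify
        rw [sq_abs, sq_abs, ← h1, hk]; ring
      · rintro ⟨a, b, ⟨h1, h2⟩, h3, h4⟩
        refine ⟨⟨?_, by omega⟩, by omega⟩
        rw [← Int.natAbs_sq z.re, ← Int.natAbs_sq z.im, ← h3, ← h4, ← h2]
        push_cast; ring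
    · rintro ⟨a, b⟩ h
      simp only [Finset.mem_image, Prod.exists, memP, Prod.mk.injEq] at h
      obtain ⟨c, d, ⟨h1, h2⟩, rfl, rfl⟩ := h
      have := hmod _ _ h2
      simp only
      omega
  rw [h0, h1]
  have hn2 : ¬ n % 3 = 2 := by omega
  have hg : gamma1 n = (if Nat.sqrt n * Nat.sqrt n = n then χ₃ (Nat.sqrt n) * (Nat.sqrt n : ℤ) else 0)
      + 2 * ∑ p ∈ P, χ₃ p.1 * p.1 := by
    unfold gamma1
    rw [if_neg hn2, if_pos hn]
  rw [hg]
  push_cast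
  ring

theorem gamma1_vanishing (n : ℕ) (hn : 0 < n) :
    gamma1 n = 0 ↔
      3 ∣ n ∨ ∃ p : ℕ, p.Prime ∧ p % 4 = 3 ∧ Odd (padicValNat p n) := by
  by_cases h3 : 3 ∣ n
  · simp only [h3, true_or, iff_true]
    unfold gamma1
    rw [if_neg (by omega), if_neg (by omega)]
  have hFg : F n = 0 ↔ gamma1 n = 0 := by
    have : n % 3 = 1 ∨ n % 3 = 2 := by omega
    rcases this with h | h
    · rw [F_eq1 n h]; simp
    · rw [F_eq2 n h]
      have : (1 + Complex.I) ≠ 0 := by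
        intro h; have := congrArg Complex.re h; simp at this
      simp [om_ne, this]
  have hS : (S n).Nonempty ↔ ∃ x y : ℕ, n = x ^ 2 + y ^ 2 := by
    constructor
    · rintro ⟨z, hz⟩
      rw [mem_S, norm_eq, ← Int.natAbs_sq z.re, ← Int.natAbs_sq z.im] at hz
      exact ⟨_, _, by exact_mod_cast hz.symm⟩
    · rintro ⟨x, y, h⟩
      refine ⟨⟨x, y⟩, mem_S.2 ?_⟩
      rw [norm_eq, h]; push_cast; rfl
  have hFS : F n = 0 ↔ ¬ (S n).Nonempty := by
    constructor
    · intro h hne; exact F_ne n hn h3 hne h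
    · intro h
      rw [Finset.not_nonempty_iff_eq_empty] at h
      simp [F, h]
  rw [← hFg, hFS, hS, Nat.eq_sq_add_sq_iff]
  simp only [h3, false_or]
  push Not
  constructor
  · rintro ⟨q, hq, h4, h⟩
    exact ⟨q, Nat.prime_of_mem_primeFactors hq, h4, by simpa using h⟩
  · rintro ⟨q, hq, h4, h⟩
    refine ⟨q, ?_, h4, by simpa using h⟩
    rw [Nat.mem_primeFactors]
    refine ⟨hq, ?_, hn.ne'⟩
    by_contra hd
    rw [padicValNat.eq_zero_of_not_dvd hd] at h
    simp at h
end

section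
/- Let r_{(1,2)}(n) := #{(x,y) ∈ ℤ² : x² + 2y² = n}. Then for every positive integer n, r_{(1,2)}(n) = 2·Σ_{d ∣ n} χ_{−8}(d), where χ_{−8}(d) = 1 if d ≡ 1 or 3 (mod 8), χ_{−8}(d) = −1 if d ≡ 5 or 7 (mod 8), and χ_{−8}(d) = 0 if d is even. In particular, r_{(1,2)}(n) = 0 if and only if there exists a prime p with p ≡ 5 (mod 8) or p ≡ 7 (mod 8) such that ord_p(n) is odd. -/
open Finset

/-- The Kronecker symbol `(-2/·)`. -/
def χm8 (m : ℕ) : ℤ :=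
  if m % 8 = 1 ∨ m % 8 = 3 then 1 else if m % 8 = 5 ∨ m % 8 = 7 then -1 else 0

/-- `r_{(1,2)}(n)`, the number of representations of `n` by the form `x² + 2y²`. -/
noncomputable def r12 (n : ℕ) : ℕ :=
  Set.ncard {p : ℤ × ℤ | p.1 ^ 2 + 2 * p.2 ^ 2 = (n : ℤ)}

def Rep12 (n : ℕ) : Set (ℤ × ℤ) := {p : ℤ × ℤ | p.1 ^ 2 + 2 * p.2 ^ 2 = (n : ℤ)}

theorem Rep_finite (n : ℕ) : (Rep12 n).Finite := by
  apply (Set.finite_Icc ((-(n:ℤ), -(n:ℤ)) : ℤ × ℤ) ((n:ℤ), (n:ℤ))).subset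
  rintro ⟨x, y⟩ h
  simp only [Rep12, Set.mem_ofPred_eq] at h
  simp only [Set.mem_Icc, Prod.mk_le_mk]
  have h1 : ∀ z : ℤ, z ^ 2 ≤ n → -(n:ℤ) ≤ z ∧ z ≤ n := by
    intro z hz
    constructor <;> nlinarith [sq_nonneg (z - 1), sq_nonneg (z + 1), sq_nonneg z, Int.le_self_sq z, Int.le_self_sq (-z)]
  have := h1 x (by nlinarith [sq_nonneg y])
  have := h1 y (by nlinarith [sq_nonneg x, sq_nonneg y])
  tauto

theorem r12_one : r12 1 = 2 := by
  have : {p : ℤ × ℤ | p.1 ^ 2 + 2 * p.2 ^ 2 = ((1:ℕ) : ℤ)} = {(1, 0), (-1, 0)} := by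
    ext ⟨x, y⟩
    simp only [Set.mem_ofPred_eq, Set.mem_insert_iff, Set.mem_singleton_iff, Prod.mk.injEq]
    constructor
    · intro h
      push_cast at h
      have hy : y = 0 := by
        by_contra hy
        have : 0 < y ^ 2 := by positivity
        nlinarith [sq_nonneg x]
      subst hy
      have : x ^ 2 = 1 := by linarith
      rcases sq_eq_sq_iff_eq_or_eq_neg.mp (this.trans (one_pow 2).symm) with h | h <;> simp [h]
    · rintro (⟨rfl, rfl⟩ | ⟨rfl, rfl⟩) <;> norm_num
  rw [r12, this, Set.ncard_pair (by simp)]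

/-- count of representations divisible by p -/
theorem ncard_div (p m : ℕ) (hp : p.Prime) :
    ({z ∈ Rep12 (p * m) | (p:ℤ) ∣ z.1 ∧ (p:ℤ) ∣ z.2}).ncard = if p ∣ m then r12 (m / p) else 0 := by
  have hp0 : (p:ℤ) ≠ 0 := by exact_mod_cast hp.ne_zero
  split_ifs with h
  · obtain ⟨k, rfl⟩ := h
    rw [Nat.mul_div_cancel_left _ hp.pos, r12]
    symm
    rw [← Set.ncard_image_of_injective (f := fun z : ℤ × ℤ => ((p:ℤ) * z.1, (p:ℤ) * z.2))]
    · congr 1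
      ext ⟨x, y⟩
      simp only [Rep12, Set.mem_image, Set.mem_ofPred_eq, Prod.mk.injEq, Prod.exists]
      constructor
      · rintro ⟨a, b, h, rfl, rfl⟩
        refine ⟨?_, by simp, by simp⟩
        push_cast
        rw [← h]; ring
      · rintro ⟨h, ⟨a, rfl⟩, ⟨b, rfl⟩⟩
        refine ⟨a, b, ?_, rfl, rfl⟩
        push_cast at h
        apply mul_left_cancel₀ (mul_ne_zero hp0 hp0)
        linear_combination h
    · rintro ⟨a, b⟩ ⟨c, d⟩ h
      simpa [hp.ne_zero] using h
  · rw [Set.ncard_eq_zero ((Rep_finite _).subset (Set.sep_subset _ _))]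
    rw [Set.eq_empty_iff_forall_notMem]
    rintro ⟨x, y⟩ ⟨h1, ⟨a, ha⟩, ⟨b, hb⟩⟩
    simp only [Rep12, Set.mem_ofPred_eq] at h1 ha hb
    subst ha hb
    apply h
    rw [← Int.natCast_dvd_natCast]
    refine ⟨a ^ 2 + 2 * b ^ 2, ?_⟩
    push_cast at h1
    apply mul_left_cancel₀ hp0
    linear_combination -h1

/-- count of representations divisible by the element a + b√-2 of norm p -/
theorem ncard_pi (p m : ℕ) (hp : p.Prime) (a b : ℤ) (hab : a ^ 2 + 2 * b ^ 2 = p) :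
    ({z ∈ Rep12 (p * m) | (p:ℤ) ∣ z.2 * a - z.1 * b}).ncard = r12 m := by
  have hp0 : (p:ℤ) ≠ 0 := by exact_mod_cast hp.ne_zero
  have hpp : Prime (p:ℤ) := Nat.prime_iff_prime_int.mp hp
  rw [r12]
  symm
  rw [← Set.ncard_image_of_injective
    (f := fun z : ℤ × ℤ => (z.1 * a - 2 * z.2 * b, z.1 * b + z.2 * a))]
  · congr 1
    ext ⟨x, y⟩
    simp only [Rep12, Set.mem_image, Set.mem_ofPred_eq, Prod.mk.injEq, Prod.exists]
    constructor
    · rintro ⟨u, v, h, rfl, rfl⟩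
      refine ⟨?_, v, ?_⟩
      · push_cast
        rw [← h, ← hab]; ring
      · rw [← hab]; ring
    · rintro ⟨h, v, hv⟩
      push_cast at h
      have h2 : (p:ℤ) ∣ (x * a + 2 * y * b) ^ 2 := by
        refine ⟨p * m - 2 * p * v ^ 2, ?_⟩
        linear_combination (a ^ 2 + 2 * b ^ 2) * h + (p * m : ℤ) * hab -
          2 * (y * a - x * b + p * v) * hv
      obtain ⟨u, hu⟩ := hpp.dvd_of_dvd_pow h2
      have hx : u * a - 2 * v * b = x := by
        apply mul_left_cancel₀ hp0
        linear_combination -a * hu + 2 * b * hv + x * hab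
      have hy : u * b + v * a = y := by
        apply mul_left_cancel₀ hp0
        linear_combination -b * hu - a * hv + y * hab
      refine ⟨u, v, ?_, hx, hy⟩
      subst hx hy
      apply mul_left_cancel₀ hp0
      rw [← h, ← hab]; ring
  · rintro ⟨u, v⟩ ⟨s, t⟩ h
    simp only [Prod.mk.injEq] at h ⊢
    obtain ⟨h1, h2⟩ := h
    constructor <;> apply mul_left_cancel₀ hp0 <;> rw [← hab]
    · linear_combination a * h1 + 2 * b * h2
    · linear_combination -b * h1 + a * h2

theorem split_rec (p m : ℕ) (hp : p.Prime) (hp2 : p ≠ 2) (a b : ℤ)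
    (hab : a ^ 2 + 2 * b ^ 2 = p) :
    r12 (p * m) + (if p ∣ m then r12 (m / p) else 0) = 2 * r12 m := by
  have hpp : Prime (p:ℤ) := Nat.prime_iff_prime_int.mp hp
  have hp0 : (p:ℤ) ≠ 0 := hpp.ne_zero
  have h2 : ¬ (p:ℤ) ∣ 2 := by
    intro h
    have : p ∣ 2 := by exact_mod_cast h
    exact hp2 ((Nat.prime_dvd_prime_iff_eq hp Nat.prime_two).mp this)
  have hna : ¬ (p:ℤ) ∣ a := by
    intro ha
    have hb : (p:ℤ) ∣ b := by
      have : (p:ℤ) ∣ 2 * b ^ 2 := by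
        have e : 2 * b ^ 2 = p - a ^ 2 := by linarith
        rw [e]
        exact dvd_sub dvd_rfl (dvd_pow ha two_ne_zero)
      exact hpp.dvd_of_dvd_pow ((hpp.dvd_or_dvd this).resolve_left h2)
    obtain ⟨s, rfl⟩ := ha
    obtain ⟨t, rfl⟩ := hb
    apply hpp.not_dvd_one
    refine ⟨s ^ 2 + 2 * t ^ 2, ?_⟩
    apply mul_left_cancel₀ hp0
    linear_combination -hab
  have hA := ncard_pi p m hp a b hab
  have hB := ncard_pi p m hp a (-b) (by linarith [hab])
  have hU : {z ∈ Rep12 (p * m) | (p:ℤ) ∣ z.2 * a - z.1 * b} ∪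
      {z ∈ Rep12 (p * m) | (p:ℤ) ∣ z.2 * a - z.1 * (-b)} = Rep12 (p * m) := by
    ext ⟨x, y⟩
    simp only [Rep12, Set.mem_union, Set.mem_ofPred_eq]
    constructor
    · rintro (h | h) <;> exact h.1
    · intro h
      have : (p:ℤ) ∣ (y * a - x * b) * (y * a - x * (-b)) := by
        refine ⟨y ^ 2 - b ^ 2 * m, ?_⟩
        push_cast at h
        linear_combination y ^ 2 * hab - b ^ 2 * h
      rcases hpp.dvd_or_dvd this with h' | h'
      · exact Or.inl ⟨h, h'⟩
      · exact Or.inr ⟨h, h'⟩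
  have hI : {z ∈ Rep12 (p * m) | (p:ℤ) ∣ z.2 * a - z.1 * b} ∩
      {z ∈ Rep12 (p * m) | (p:ℤ) ∣ z.2 * a - z.1 * (-b)} =
      {z ∈ Rep12 (p * m) | (p:ℤ) ∣ z.1 ∧ (p:ℤ) ∣ z.2} := by
    ext ⟨x, y⟩
    simp only [Set.mem_inter_iff, Set.mem_ofPred_eq]
    constructor
    · rintro ⟨⟨h, h1⟩, -, h3⟩
      have hy : (p:ℤ) ∣ y := by
        have : (p:ℤ) ∣ 2 * (y * a) := by
          have := dvd_add h1 h3
          ring_nf at this ⊢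
          exact this
        exact (hpp.dvd_or_dvd ((hpp.dvd_or_dvd this).resolve_left h2)).resolve_right hna
      refine ⟨h, ?_, hy⟩
      simp only [Rep12, Set.mem_ofPred_eq] at h
      have : (p:ℤ) ∣ x ^ 2 := by
        have e : x ^ 2 = p * m - 2 * y ^ 2 := by push_cast at h; linarith
        rw [e]
        exact dvd_sub (dvd_mul_right _ _) (Dvd.dvd.mul_left (dvd_pow hy two_ne_zero) _)
      exact hpp.dvd_of_dvd_pow this
    · rintro ⟨h, hx, hy⟩
      exact ⟨⟨h, dvd_sub (hy.mul_right _) (hx.mul_right _)⟩, h,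
        dvd_sub (hy.mul_right _) (hx.mul_right _)⟩
  have key := Set.ncard_union_add_ncard_inter
    {z ∈ Rep12 (p * m) | (p:ℤ) ∣ z.2 * a - z.1 * b}
    {z ∈ Rep12 (p * m) | (p:ℤ) ∣ z.2 * a - z.1 * (-b)}
    ((Rep_finite _).subset (Set.sep_subset _ _)) ((Rep_finite _).subset (Set.sep_subset _ _))
  rw [hU, hI, hA, hB, ncard_div p m hp] at key
  rw [two_mul, ← key]
  rfl

theorem inert_rec (p m : ℕ) (hp : p.Prime) (h8 : p % 8 = 5 ∨ p % 8 = 7) :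
    r12 (p * m) = (if p ∣ m then r12 (m / p) else 0) := by
  have hpp : Prime (p:ℤ) := Nat.prime_iff_prime_int.mp hp
  rw [← ncard_div p m hp, r12]
  congr 1
  ext ⟨x, y⟩
  simp only [Rep12, Set.mem_ofPred_eq]
  constructor
  · intro h
    refine ⟨h, ?_⟩
    push_cast at h
    have hy : (p:ℤ) ∣ y := by
      by_contra hy
      have : Fact p.Prime := ⟨hp⟩
      have hsq : IsSquare (-2 : ZMod p) := by
        have hy' : (y : ZMod p) ≠ 0 := by
          rwa [Ne, ZMod.intCast_zmod_eq_zero_iff_dvd]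
        have h' : (x : ZMod p) ^ 2 + 2 * (y : ZMod p) ^ 2 = 0 := by
          have := congrArg (Int.cast : ℤ → ZMod p) h
          push_cast at this
          simpa using this
        refine ⟨x / y, ?_⟩
        field_simp
        linear_combination -h'
      rw [ZMod.exists_sq_eq_neg_two_iff (by omega)] at hsq
      omega
    refine ⟨?_, hy⟩
    have : (p:ℤ) ∣ x ^ 2 := by
      have e : x ^ 2 = p * m - 2 * y ^ 2 := by linarith
      rw [e]
      exact dvd_sub (dvd_mul_right _ _) (Dvd.dvd.mul_left (dvd_pow hy two_ne_zero) _)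
    exact hpp.dvd_of_dvd_pow this
  · exact fun h => h.1

theorem two_rec (m : ℕ) : r12 (2 * m) = r12 m := by
  rw [r12, r12]
  symm
  rw [← Set.ncard_image_of_injective (f := fun z : ℤ × ℤ => (2 * z.2, z.1))]
  · congr 1
    ext ⟨x, y⟩
    simp only [Set.mem_image, Set.mem_ofPred_eq, Prod.mk.injEq, Prod.exists]
    constructor
    · rintro ⟨u, v, h, rfl, rfl⟩
      push_cast
      rw [← h]; ring
    · intro h
      push_cast at h
      have : (2:ℤ) ∣ x ^ 2 := ⟨m - y ^ 2, by linarith⟩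
      obtain ⟨u, rfl⟩ := Int.prime_two.dvd_of_dvd_pow this
      exact ⟨y, u, by linarith, rfl, rfl⟩
  · rintro ⟨u, v⟩ ⟨s, t⟩ h
    simp only [Prod.mk.injEq] at h ⊢
    omega

theorem centered (k : ℕ) (hk : 0 < k) (x : ℤ) : ∃ q r : ℤ, x = k * q + r ∧ 4 * r ^ 2 ≤ k ^ 2 := by
  refine ⟨(x - Int.bmod x k) / k, Int.bmod x k, ?_, ?_⟩
  · rw [Int.mul_ediv_cancel']
    · ring
    · exact Int.dvd_self_sub_bmod
  · have h1 := Int.le_bmod (x := x) (m := k) hk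
    have h2 := Int.bmod_le (x := x) (m := k) hk
    have h3 : -(k:ℤ) ≤ 2 * Int.bmod x k := by omega
    have h4 : 2 * Int.bmod x k ≤ k := by omega
    nlinarith

theorem descent (p : ℕ) (hp : p.Prime) : ∀ k : ℕ, 0 < k → k < p →
    (∃ x y : ℤ, x ^ 2 + 2 * y ^ 2 = k * p) → ∃ a b : ℤ, a ^ 2 + 2 * b ^ 2 = p := by
  intro k
  induction k using Nat.strong_induction_on with
  | _ k ih =>
    rintro hk hkp ⟨x, y, h⟩
    by_cases hk1 : k = 1
    · subst hk1
      exact ⟨x, y, by simpa using h⟩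
    have hk0 : (k:ℤ) ≠ 0 := by exact_mod_cast hk.ne'
    have hkpos : (0:ℤ) < k := by exact_mod_cast hk
    obtain ⟨q, r, hq, hr⟩ := centered k hk x
    obtain ⟨s, t, hs, ht⟩ := centered k hk y
    obtain ⟨l, hl⟩ : (k:ℤ) ∣ r ^ 2 + 2 * t ^ 2 := by
      refine ⟨p - (k * q ^ 2 + 2 * q * r) - 2 * (k * s ^ 2 + 2 * s * t), ?_⟩
      subst hq hs
      linear_combination h
    have hl0 : 0 ≤ l := by
      by_contra hlt
      push Not at hlt
      nlinarith [sq_nonneg r, sq_nonneg t]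
    have hlk : l < k := by
      by_contra hlt
      push Not at hlt
      nlinarith
    have hlne : l ≠ 0 := by
      rintro rfl
      have ht0 : t = 0 := by
        by_contra h0
        have : 0 < t ^ 2 := by positivity
        nlinarith [sq_nonneg r]
      have hr0 : r = 0 := by
        by_contra h0
        have : 0 < r ^ 2 := by positivity
        nlinarith [sq_nonneg t]
      subst ht0 hr0
      have : (k:ℤ) ∣ p := by
        refine ⟨q ^ 2 + 2 * s ^ 2, ?_⟩
        apply mul_left_cancel₀ hk0
        rw [← h, hq, hs]; ring
      have : k ∣ p := by exact_mod_cast this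
      rcases (Nat.dvd_prime hp).mp this with h | h <;> omega
    lift l to ℕ using hl0
    refine ih l (by exact_mod_cast hlk) (by omega) (by omega) ?_
    refine ⟨(l + q * r + 2 * s * t), (s * r - q * t), ?_⟩
    apply mul_left_cancel₀ (mul_ne_zero hk0 hk0)
    have e1 : k * (l + q * r + 2 * s * t) = x * r + 2 * y * t := by
      rw [hq, hs]; linear_combination -hl
    have e2 : k * (s * r - q * t) = y * r - x * t := by
      rw [hq, hs]; ring
    calc (k:ℤ) * k * ((l + q * r + 2 * s * t) ^ 2 + 2 * (s * r - q * t) ^ 2)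
        = (k * (l + q * r + 2 * s * t)) ^ 2 + 2 * (k * (s * r - q * t)) ^ 2 := by ring
      _ = (x ^ 2 + 2 * y ^ 2) * (r ^ 2 + 2 * t ^ 2) := by rw [e1, e2]; ring
      _ = k * k * (l * p) := by rw [h, hl]; ring

theorem exists_rep (p : ℕ) (hp : p.Prime) (h8 : p % 8 = 1 ∨ p % 8 = 3) :
    ∃ a b : ℤ, a ^ 2 + 2 * b ^ 2 = p := by
  have : Fact p.Prime := ⟨hp⟩
  have hp3 : 3 ≤ p := by have := hp.two_le; omega
  obtain ⟨w, hw⟩ := (ZMod.exists_sq_eq_neg_two_iff (p := p) (by omega)).mpr h8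
  obtain ⟨q, r, hq, hr⟩ := centered p hp.pos (w.val : ℤ)
  have : (p:ℤ) ∣ r ^ 2 + 2 := by
    rw [← ZMod.intCast_zmod_eq_zero_iff_dvd]
    have e : (r : ZMod p) = w := by
      have := congrArg (Int.cast : ℤ → ZMod p) hq
      push_cast at this
      simpa using this.symm
    push_cast
    rw [e]
    linear_combination -hw
  obtain ⟨k, hk⟩ := this
  have hp3' : (3:ℤ) ≤ p := by exact_mod_cast hp3
  have hk0 : 0 < k := by
    by_contra h0
    push Not at h0
    nlinarith [sq_nonneg r]
  have hkp : k < p := by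
    by_contra h0
    push Not at h0
    nlinarith [sq_nonneg r]
  lift k to ℕ using hk0.le
  exact descent p hp k (by omega) (by omega) ⟨r, 1, by linarith⟩

theorem χm8_mul (a b : ℕ) : χm8 (a * b) = χm8 a * χm8 b := by
  have ha := Nat.mod_lt a (by norm_num : 0 < 8)
  have hb := Nat.mod_lt b (by norm_num : 0 < 8)
  unfold χm8
  rw [Nat.mul_mod]
  generalize a % 8 = u at *
  generalize b % 8 = v at *
  interval_cases u <;> interval_cases v <;> rfl

def Sd (n : ℕ) : ℤ := ∑ d ∈ n.divisors, χm8 d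

theorem Sd_rec (p m : ℕ) (hp : p.Prime) (hm : 0 < m) :
    Sd (p * m) + χm8 p * (if p ∣ m then Sd (m / p) else 0) = (1 + χm8 p) * Sd m := by
  have himg : ∀ k, ∑ d ∈ (k.divisors).image (p * ·), χm8 d = χm8 p * Sd k := by
    intro k
    rw [sum_image (fun a _ b _ h => Nat.eq_of_mul_eq_mul_left hp.pos h), Sd, mul_sum]
    exact sum_congr rfl fun d _ => χm8_mul p d
  have hU : (p * m).divisors = m.divisors ∪ (m.divisors).image (p * ·) := by
    ext d
    simp only [Nat.mem_divisors, mem_union, mem_image]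
    constructor
    · rintro ⟨h, -⟩
      by_cases hd : p ∣ d
      · obtain ⟨e, rfl⟩ := hd
        exact Or.inr ⟨e, ⟨Nat.dvd_of_mul_dvd_mul_left hp.pos h, hm.ne'⟩, rfl⟩
      · exact Or.inl ⟨(((Nat.Prime.coprime_iff_not_dvd hp).mpr hd).symm).dvd_of_dvd_mul_left h, hm.ne'⟩
    · have := mul_ne_zero hp.ne_zero hm.ne'
      rintro (⟨h, -⟩ | ⟨e, ⟨h, -⟩, rfl⟩)
      · exact ⟨h.mul_left _, this⟩
      · exact ⟨Nat.mul_dvd_mul_left _ h, this⟩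
  have hI : ∑ d ∈ m.divisors ∩ (m.divisors).image (p * ·), χm8 d =
      χm8 p * (if p ∣ m then Sd (m / p) else 0) := by
    split_ifs with h
    · obtain ⟨k, rfl⟩ := h
      rw [Nat.mul_div_cancel_left _ hp.pos, ← himg]
      congr 1
      have hk : k ≠ 0 := by rintro rfl; simp at hm
      ext d
      simp only [Nat.mem_divisors, mem_inter, mem_image]
      constructor
      · rintro ⟨⟨h1, h2⟩, e, -, rfl⟩
        exact ⟨e, ⟨Nat.dvd_of_mul_dvd_mul_left hp.pos h1, hk⟩, rfl⟩
      · rintro ⟨e, ⟨h, -⟩, rfl⟩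
        exact ⟨⟨Nat.mul_dvd_mul_left _ h, hm.ne'⟩, e, ⟨h.mul_left _, hm.ne'⟩, rfl⟩
    · rw [mul_zero]
      apply sum_eq_zero
      intro d hd
      simp only [Nat.mem_divisors, mem_inter, mem_image] at hd
      obtain ⟨⟨h1, -⟩, e, -, rfl⟩ := hd
      exact absurd (dvd_of_mul_right_dvd h1) h
  have := sum_union_inter (s₁ := m.divisors) (s₂ := (m.divisors).image (p * ·)) (f := χm8)
  rw [← hU, hI, himg] at this
  have e : Sd (p * m) = ∑ d ∈ (p * m).divisors, χm8 d := rfl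
  have e' : Sd m = ∑ d ∈ m.divisors, χm8 d := rfl
  rw [e, this, ← e']; ring

theorem r12_eq (n : ℕ) : 0 < n → (r12 n : ℤ) = 2 * Sd n := by
  induction n using Nat.strong_induction_on with
  | _ n ih =>
    intro hn
    by_cases h1 : n = 1
    · subst h1; rw [r12_one]; simp [Sd, χm8]
    obtain ⟨p, hp, m, rfl⟩ := Nat.exists_prime_and_dvd h1
    have hm : 0 < m := Nat.pos_of_mul_pos_left hn
    have hlt : m < p * m := by nlinarith [hp.two_le]
    have ihm := ih m hlt hm
    have hS := Sd_rec p m hp hm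
    have ihd : (((if p ∣ m then r12 (m / p) else 0) : ℕ) : ℤ) =
        2 * (if p ∣ m then Sd (m / p) else 0) := by
      split_ifs with h
      · exact ih _ ((Nat.div_le_self _ _).trans_lt hlt) (Nat.div_pos (Nat.le_of_dvd hm h) hp.pos)
      · simp
    by_cases h2 : p = 2
    · subst h2
      rw [two_rec, ihm]
      have : χm8 2 = 0 := rfl
      rw [this] at hS
      linarith
    have hodd : p % 2 = 1 := hp.eq_two_or_odd.resolve_left h2
    by_cases h13 : p % 8 = 1 ∨ p % 8 = 3
    · obtain ⟨a, b, hab⟩ := exists_rep p hp h13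
      have hr := split_rec p m hp h2 a b hab
      have : χm8 p = 1 := by simp [χm8, h13]
      rw [this] at hS
      have hr := congrArg (Nat.cast : ℕ → ℤ) hr
      rw [Nat.cast_add, ihd] at hr
      push_cast at hr
      linarith
    · have h57 : p % 8 = 5 ∨ p % 8 = 7 := by omega
      have : χm8 p = -1 := by simp [χm8, h13, h57]
      rw [this] at hS
      rw [inert_rec p m hp h57, ihd]
      linarith

theorem Sd_mul (a b : ℕ) (h : a.Coprime b) : Sd (a * b) = Sd a * Sd b := by
  rw [Sd, Sd, Sd, sum_mul_sum, ← sum_product', Nat.divisors_mul, Finset.mul_def,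
    sum_image h.mul_injOn_divisors]
  exact sum_congr rfl fun d _ => χm8_mul _ _

theorem χm8_pow (p i : ℕ) : χm8 (p ^ i) = χm8 p ^ i := by
  induction i with
  | zero => simp [χm8]
  | succ i ih => rw [pow_succ, pow_succ, χm8_mul, ih]

theorem Sd_pow (p k : ℕ) (hp : p.Prime) :
    Sd (p ^ k) = 0 ↔ (p % 8 = 5 ∨ p % 8 = 7) ∧ Odd k := by
  have e : Sd (p ^ k) = ∑ i ∈ range (k + 1), χm8 p ^ i := by
    rw [Sd, Nat.sum_divisors_prime_pow hp]
    exact sum_congr rfl fun i _ => χm8_pow p i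
  rw [e]
  by_cases h57 : p % 8 = 5 ∨ p % 8 = 7
  · have : χm8 p = -1 := by
      have h : ¬ (p % 8 = 1 ∨ p % 8 = 3) := by omega
      simp [χm8, h, h57]
    rw [this, neg_one_geom_sum]
    simp [h57, Nat.even_add_one]
  · simp only [h57, false_and, iff_false]
    rw [sum_range_succ']
    have : 0 ≤ χm8 p := by
      unfold χm8
      split_ifs <;> simp
    have := sum_nonneg (s := range k) (f := fun i => χm8 p ^ (i + 1)) (fun i _ => by positivity)
    simp only [pow_zero]
    omega

theorem Sd_zero (n : ℕ) (hn : 0 < n) : Sd n = 0 ↔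
    ∃ p : ℕ, p.Prime ∧ (p % 8 = 5 ∨ p % 8 = 7) ∧ Odd (padicValNat p n) := by
  rw [Nat.multiplicative_factorization Sd Sd_mul (by simp [Sd, χm8]) hn.ne', Finsupp.prod,
    prod_eq_zero_iff]
  constructor
  · rintro ⟨p, hp, h⟩
    have hpp := Nat.prime_of_mem_primeFactors hp
    rw [Sd_pow _ _ hpp, Nat.factorization_def _ hpp] at h
    exact ⟨p, hpp, h⟩
  · rintro ⟨p, hpp, h⟩
    refine ⟨p, ?_, ?_⟩
    · rw [Finsupp.mem_support_iff, Nat.factorization_def _ hpp]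
      exact h.2.pos.ne'
    · rw [Sd_pow _ _ hpp, Nat.factorization_def _ hpp]
      exact h

theorem r12_formula_and_vanishing (n : ℕ) (hn : 0 < n) :
    (r12 n : ℤ) = 2 * ∑ d ∈ n.divisors, χm8 d ∧
    (r12 n = 0 ↔
      ∃ p : ℕ, p.Prime ∧ (p % 8 = 5 ∨ p % 8 = 7) ∧ Odd (padicValNat p n)) := by
  have h := r12_eq n hn
  refine ⟨h, ?_⟩
  rw [← Sd_zero n hn]
  constructor
  · intro h0
    rw [h0] at h
    push_cast at h
    linarith
  · intro h0
    rw [h0] at h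
    exact_mod_cast h
end
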